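/- Let O be a Dedekind domain and A a commutative Frobenius O-algebra that is finitely generated projective of rank n as an O-module, with nondegenerate trace ε : A → O (meaning a ↦ (b ↦ ε(ab)) is an O-module isomorphism A → Hom_O(A,O)). Writing A ≅ O^{n-1} ⊕ P for a rank-one projective P, the class of P has order at most two in the ideal class group of O. -/

import Mathlib

open TensorProduct

/-- A finite projective module of rank one over a domain is, modulo any maximal ideal,
generated by a single nonzero element. -/
theorem exists_generator_modulo_maximal {R P : Type*} [CommRing R] [IsDomain R]
    [AddCommGroup P] [Module R P] [Module.Finite R P] [Module.Projective R P]
    (hP : Module.finrank R P = 1) (m : Ideal R) [m.IsMaximal] :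
    ∃ p : P, p ∉ m • (⊤ : Submodule R P) ∧
      ∀ q : P, ∃ a : R, q - a • p ∈ m • (⊤ : Submodule R P) := by
  have hdim : Module.finrank m.ResidueField (m.ResidueField ⊗[R] P) = 1 :=
    (m.finrank_fiber_eq_finrank (M := P)).trans hP
  have hbij := m.bijective_algebraMap_quotient_residueField
  have hsurj := m.algebraMap_residueField_surjective
  let e : (R ⧸ m) ≃ₗ[R] m.ResidueField :=
    .ofBijective (IsScalarTower.toAlgHom R (R ⧸ m) m.ResidueField).toLinearMap hbij
  let L : m.ResidueField ⊗[R] P ≃ₗ[R] P ⧸ (m • (⊤ : Submodule R P)) :=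
    e.symm.rTensor P ≪≫ₗ quotTensorEquivQuotSMul P m
  obtain ⟨v, hv, hgen⟩ := finrank_eq_one_iff'.mp hdim
  obtain ⟨p, hp⟩ := Submodule.Quotient.mk_surjective _ (L v)
  have hpv : L.symm (Submodule.Quotient.mk p) = v := by simp [hp]
  refine ⟨p, fun h ↦ hv ?_, fun q ↦ ?_⟩
  · rw [← hpv, (Submodule.Quotient.mk_eq_zero _).mpr h, map_zero]
  · obtain ⟨c, hc⟩ := hgen (L.symm (Submodule.Quotient.mk q))
    obtain ⟨a, rfl⟩ := hsurj c
    refine ⟨a, (Submodule.Quotient.mk_eq_zero _).mp (L.symm.injective ?_)⟩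
    rw [Submodule.Quotient.mk_sub, Submodule.Quotient.mk_smul, map_sub, map_smul, hpv, ← hc,
      algebraMap_smul, sub_self, map_zero]

theorem LinearMap.apply_mem_of_mem_smul_top {R M : Type*} [CommRing R] [AddCommGroup M]
    [Module R M] {I : Ideal R} (f : M →ₗ[R] R) {x : M} (hx : x ∈ I • (⊤ : Submodule R M)) :
    f x ∈ I := by
  simpa using Submodule.smul_top_le_comap_smul_top I f hx

/-- The radical of a perfect pairing modulo an ideal `I` is trivial modulo `I`. -/
theorem mem_smul_top_of_forall_apply_mem {R M : Type*} [CommRing R] [AddCommGroup M] [Module R M]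
    [Module.Finite R M] [Module.Projective R M] {B : M →ₗ[R] M →ₗ[R] R}
    (hB : Function.Bijective B) {I : Ideal R} {x : M} (hx : ∀ y, B x y ∈ I) :
    x ∈ I • (⊤ : Submodule R M) := by
  obtain ⟨n, f, g, -, -, hfg⟩ := Module.Finite.exists_comp_eq_id_of_projective R M
  let b := LinearEquiv.ofBijective B hB
  have hsum : B x = ∑ i, B x (f (Pi.single i 1)) • (LinearMap.proj i ∘ₗ g) := by
    ext y
    have hy : f (g y) = y := LinearMap.congr_fun hfg y
    conv_lhs => rw [← hy, ← Finset.univ_sum_single (g y)]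
    simp only [map_sum, LinearMap.sum_apply, LinearMap.smul_apply, LinearMap.comp_apply,
      LinearMap.proj_apply, smul_eq_mul]
    refine Finset.sum_congr rfl fun i _ ↦ ?_
    rw [mul_comm, ← smul_eq_mul, ← map_smul, ← map_smul, ← Pi.single_smul, smul_eq_mul, mul_one]
  have hxb : x = b.symm (B x) := (b.symm_apply_apply x).symm
  rw [hxb, hsum, map_sum]
  refine Submodule.sum_mem _ fun i _ ↦ ?_
  rw [map_smul]
  exact Submodule.smul_mem_smul (hx _) trivial

section GramDeterminant

variable {R ι P : Type*} [CommRing R] [DecidableEq ι] [AddCommGroup P] [Module R P]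

/-- The standard basis of `ι → R` together with an element `p` of `P`, as a family of
elements of `(ι → R) × P`. -/
def stdFamily (R ι : Type*) {P : Type*} [CommRing R] [DecidableEq ι] [AddCommGroup P]
    (p : P) : Option ι → (ι → R) × P
  | some i => (Pi.single i 1, 0)
  | none => (0, p)

/-- The matrix of a bilinear form on `(ι → R) × P` with respect to the families
`stdFamily R ι p` and `stdFamily R ι q`. -/
def gramMatrix (B : (ι → R) × P →ₗ[R] (ι → R) × P →ₗ[R] R) (p q : P) :
    Matrix (Option ι) (Option ι) R :=
  .of fun i j ↦ B (stdFamily R ι p i) (stdFamily R ι q j)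

theorem gramMatrix_eq_updateRow (B : (ι → R) × P →ₗ[R] (ι → R) × P →ₗ[R] R) (p q : P) :
    gramMatrix B p q = (gramMatrix B 0 q).updateRow none fun j ↦ B (0, p) (stdFamily R ι q j) := by
  ext (_ | i) j <;> simp [gramMatrix, stdFamily, Matrix.updateRow_apply]

theorem gramMatrix_eq_updateCol (B : (ι → R) × P →ₗ[R] (ι → R) × P →ₗ[R] R) (p q : P) :
    gramMatrix B p q = (gramMatrix B p 0).updateCol none fun i ↦ B (stdFamily R ι p i) (0, q) := by
  ext i (_ | j) <;> simp [gramMatrix, stdFamily]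

variable [Fintype ι]

/-- The Gram determinant as a bilinear form on `P`. -/
def gramDet (B : (ι → R) × P →ₗ[R] (ι → R) × P →ₗ[R] R) : P →ₗ[R] P →ₗ[R] R :=
  LinearMap.mk₂ R (fun p q ↦ (gramMatrix B p q).det)
    (fun p p' q ↦ by
      rw [gramMatrix_eq_updateRow, gramMatrix_eq_updateRow B p, gramMatrix_eq_updateRow B p',
        ← Matrix.det_updateRow_add]
      congr 2
      ext j
      rw [Pi.add_apply, ← LinearMap.add_apply, ← map_add, Prod.mk_add_mk, add_zero])
    (fun c p q ↦ by
      rw [gramMatrix_eq_updateRow, gramMatrix_eq_updateRow B p, smul_eq_mul,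
        ← Matrix.det_updateRow_smul]
      congr 2
      ext j
      rw [Pi.smul_apply, ← LinearMap.smul_apply, ← map_smul, Prod.smul_mk, smul_zero])
    (fun p q q' ↦ by
      rw [gramMatrix_eq_updateCol, gramMatrix_eq_updateCol B p q, gramMatrix_eq_updateCol B p q',
        ← Matrix.det_updateCol_add]
      congr 2
      ext j
      rw [Pi.add_apply, ← map_add, Prod.mk_add_mk, add_zero])
    (fun c p q ↦ by
      rw [gramMatrix_eq_updateCol, gramMatrix_eq_updateCol B p q, smul_eq_mul,
        ← Matrix.det_updateCol_smul]
      congr 2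
      ext j
      rw [Pi.smul_apply, ← map_smul, Prod.smul_mk, smul_zero])

theorem sum_smul_stdFamily (a : Option ι → R) (p : P) :
    ∑ i, a i • stdFamily R ι p i = (fun i ↦ a (some i), a none • p) := by
  have h : ∑ i, a (some i) • (Pi.single i 1 : ι → R) = fun i ↦ a (some i) := by
    ext j
    simp [Finset.sum_apply, Pi.single_apply]
  ext1
  · simp [Fintype.sum_option, stdFamily, Prod.fst_sum, h]
  · simp [Fintype.sum_option, stdFamily, Prod.snd_sum]

/-- If `p` generates `P` modulo a maximal ideal `m` and is nonzero there, then the Gram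
determinant of a perfect pairing at `p` is a unit modulo `m`. -/
theorem gramDet_notMem [Module.Finite R P] [Module.Projective R P]
    {B : (ι → R) × P →ₗ[R] (ι → R) × P →ₗ[R] R} (hB : Function.Bijective B)
    {m : Ideal R} [m.IsMaximal] {p : P} (hp : p ∉ m • (⊤ : Submodule R P))
    (hgen : ∀ q : P, ∃ a : R, q - a • p ∈ m • (⊤ : Submodule R P)) :
    gramDet B p p ∉ m := by
  intro hdet
  have hdet' : ((Ideal.Quotient.mk m).mapMatrix (gramMatrix B p p)).det = 0 := by
    rw [← RingHom.map_det]
    exact Ideal.Quotient.eq_zero_iff_mem.mpr hdet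
  obtain ⟨v, hv0, hv⟩ := Matrix.exists_vecMul_eq_zero_iff.mpr hdet'
  choose a ha using fun i ↦ Ideal.Quotient.mk_surjective (v i)
  let x := ∑ i, a i • stdFamily R ι p i
  have hx_std (j : Option ι) : B x (stdFamily R ι p j) ∈ m := by
    rw [← Ideal.Quotient.eq_zero_iff_mem]
    simpa [x, Matrix.vecMul, dotProduct, gramMatrix, ha] using congrFun hv j
  have hx (y : (ι → R) × P) : B x y ∈ m := by
    obtain ⟨c, hc⟩ := hgen y.2
    let d : Option ι → R := fun i ↦ i.elim c y.1
    have hy : y = ∑ i, d i • stdFamily R ι p i + LinearMap.inr R (ι → R) P (y.2 - c • p) := by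
      rw [sum_smul_stdFamily]
      ext1 <;> simp [d]
    rw [hy, map_add, map_sum]
    refine m.add_mem (m.sum_mem fun i _ ↦ ?_)
      ((B x ∘ₗ LinearMap.inr R (ι → R) P).apply_mem_of_mem_smul_top hc)
    rw [map_smul]
    exact m.mul_mem_left _ (hx_std i)
  have hxm := mem_smul_top_of_forall_apply_mem hB hx
  have hxe : x = (fun i ↦ a (some i), a none • p) := sum_smul_stdFamily a p
  have hsome (i : ι) : a (some i) ∈ m := by
    simpa [hxe] using (LinearMap.proj i ∘ₗ LinearMap.fst R (ι → R) P).apply_mem_of_mem_smul_top hxm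
  have hnone : a none ∈ m := by
    by_contra h
    have hap : a none • p ∈ m • (⊤ : Submodule R P) := by
      simpa [hxe] using Submodule.smul_top_le_comap_smul_top m (LinearMap.snd R (ι → R) P) hxm
    obtain ⟨c, hc⟩ := Ideal.IsMaximal.exists_inv ‹_› h
    obtain ⟨i, hi, hci⟩ := hc
    apply hp
    rw [← one_smul R p, ← hci, add_smul, mul_smul]
    exact add_mem (Submodule.smul_mem _ _ hap) (Submodule.smul_mem_smul hi trivial)
  refine hv0 (funext fun i ↦ ?_)
  rw [← ha i]
  exact Ideal.Quotient.eq_zero_iff_mem.mpr (i.rec hnone hsome)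

/-- A perfect pairing on `(ι → R) × P`, with `P` projective of rank one over a domain `R`,
trivializes `P ⊗ P`. -/
theorem nonempty_tensor_self_equiv [IsDomain R] [Module.Finite R P] [Module.Projective R P]
    (hP : Module.finrank R P = 1)
    {B : (ι → R) × P →ₗ[R] (ι → R) × P →ₗ[R] R} (hB : Function.Bijective B) :
    Nonempty (P ⊗[R] P ≃ₗ[R] R) := by
  have hsurj : Function.Surjective (TensorProduct.lift (gramDet B)) := by
    rw [← LinearMap.range_eq_top]
    by_contra h
    obtain ⟨m, hm, hle⟩ := Ideal.exists_le_maximal _ h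
    obtain ⟨p, hp, hgen⟩ := exists_generator_modulo_maximal hP m
    exact gramDet_notMem hB hp hgen (hle ⟨p ⊗ₜ p, TensorProduct.lift.tmul p p⟩)
  refine ⟨.ofBijective _ (Module.bijective_of_surjective_of_rankAtStalk_eq hsurj fun m _ ↦ ?_)⟩
  have hrank : Module.rankAtStalk P ⟨m, inferInstance⟩ = 1 := by
    rw [← m.finrank_fiber_eq_rankAtStalk, m.finrank_fiber_eq_finrank, hP]
  rw [Module.rankAtStalk_tensorProduct, Pi.mul_apply, hrank, Module.rankAtStalk_self]
  simp

end GramDeterminant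


/-- For a commutative Frobenius algebra `A` over a Dedekind domain `O`, finitely generated
projective of rank `n`, with nondegenerate trace `ε`, writing `A ≅ O^{n-1} ⊕ P` with `P`
rank-one projective, the class of `P` has order at most two: `P ⊗ P ≅ O`. -/
theorem stmt1 (O : Type*) [CommRing O] [IsDomain O] [IsDedekindDomain O]
    (A : Type*) [CommRing A] [Algebra O A] [Module.Finite O A] [Module.Projective O A]
    (n : ℕ) (hn : 0 < n) (hrankA : Module.rank O A = n)
    (P : Type*) [AddCommGroup P] [Module O P] [Module.Finite O P] [Module.Projective O P]
    (hrankP : Module.rank O P = 1)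
    (hdecomp : Nonempty (A ≃ₗ[O] ((Fin (n - 1) → O) × P)))
    (ε : A →ₗ[O] O)
    (hnd : Function.Bijective fun a : A => ε.comp (LinearMap.mulLeft O a)) :
    Nonempty (TensorProduct O P P ≃ₗ[O] O) := by
  obtain ⟨e⟩ := hdecomp
  let B : A →ₗ[O] A →ₗ[O] O := (LinearMap.mul O A).compr₂ ε
  have hB : Function.Bijective B := hnd
  exact nonempty_tensor_self_equiv (B := B.compl₁₂ e.symm.toLinearMap e.symm.toLinearMap)
    (Module.finrank_eq_of_rank_eq (by simpa using hrankP))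
    (e.symm.dualMap.bijective.comp (hB.comp e.symm.bijective))
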